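/- arXiv:2304.12642 — 2 statements merged into one kernel-verified Lean document; each statement's English description precedes it below -/
import Mathlib

section
/- Let F be a 2-CNF formula over a variable type V that is satisfiable, let T be a truth assignment that satisfies F, and let A be a conflict-free set of assumptions (a set of literals containing no literal together with its negation). Then F is satisfiable under the assumptions A (i.e., some truth assignment satisfies F and makes every literal of A agree with it) if and only if the set R_{A,T} does not contain any pair of complementing literals l and ¬l. -/
/-- Negation of a literal `(v, b)` is `(v, ¬b)`. -/
def negLit {V : Type*} (l : V × Bool) : V × Bool := (l.1, !l.2)

/-- A literal `(v, b)` agrees with the truth assignment `T` if `T v = b`. -/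
def agrees {V : Type*} (T : V → Bool) (l : V × Bool) : Prop := T l.1 = l.2

/-- `T` satisfies a clause if at least one of its two literals agrees with `T`. -/
def satClause {V : Type*} (T : V → Bool) (c : (V × Bool) × (V × Bool)) : Prop :=
  agrees T c.1 ∨ agrees T c.2

/-- `T` satisfies a 2-CNF formula `F` (a set of clauses) if it satisfies every clause. -/
def satisfies {V : Type*} (T : V → Bool) (F : Set ((V × Bool) × (V × Bool))) : Prop :=
  ∀ c ∈ F, satClause T c

/-- Edge relation of the implication graph `G_F`: for each clause `(l₁, l₂)` of `F`,
there are edges from `¬l₁` to `l₂` and from `¬l₂` to `l₁`. -/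
def edge {V : Type*} (F : Set ((V × Bool) × (V × Bool))) (l l' : V × Bool) : Prop :=
  ∃ c ∈ F, (l = negLit c.1 ∧ l' = c.2) ∨ (l = negLit c.2 ∧ l' = c.1)

/-- `R_{A,T}`: the set of literals reachable in `G_F` from some literal of `A` by a path
in which every traversed edge leaves a literal that disagrees with `T`. -/
def RAT {V : Type*} (F : Set ((V × Bool) × (V × Bool))) (A : Set (V × Bool))
    (T : V → Bool) : Set (V × Bool) :=
  { l | ∃ a ∈ A, Relation.ReflTransGen (fun x y => edge F x y ∧ ¬ agrees T x) a l }

/-- `F` is satisfiable under the assumptions `A`: some truth assignment satisfies `F`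
and makes every literal of `A` agree with it. -/
def satUnder {V : Type*} (F : Set ((V × Bool) × (V × Bool))) (A : Set (V × Bool)) : Prop :=
  ∃ T : V → Bool, satisfies T F ∧ ∀ l ∈ A, agrees T l

/-- A satisfying assignment that makes the tail of an edge true makes its head true. -/
theorem agrees_of_edge {V : Type*} {F : Set ((V × Bool) × (V × Bool))} {T : V → Bool}
    (hT : satisfies T F) {l l' : V × Bool} (h : edge F l l') (hl : agrees T l) :
    agrees T l' := by
  obtain ⟨c, hc, ⟨rfl, rfl⟩ | ⟨rfl, rfl⟩⟩ := h <;>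
    have := hT c hc <;> simp_all [satClause, agrees, negLit]

/-- A satisfying assignment that makes all of `A` true makes all of `RAT F A S` true. -/
theorem agrees_of_mem_RAT {V : Type*} {F : Set ((V × Bool) × (V × Bool))} {A : Set (V × Bool)}
    {S T : V → Bool} (hT : satisfies T F) (hA : ∀ l ∈ A, agrees T l) {l : V × Bool}
    (hl : l ∈ RAT F A S) : agrees T l := by
  obtain ⟨a, ha, h⟩ := hl
  induction h with
  | refl => exact hA a ha
  | tail _ h ih => exact agrees_of_edge hT h.1 ih

theorem mem_RAT_of_edge {V : Type*} {F : Set ((V × Bool) × (V × Bool))} {A : Set (V × Bool)}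
    {T : V → Bool} {l l' : V × Bool} (hl : l ∈ RAT F A T) (h : edge F l l')
    (hd : ¬ agrees T l) : l' ∈ RAT F A T := by
  obtain ⟨a, ha, hal⟩ := hl
  exact ⟨a, ha, hal.tail ⟨h, hd⟩⟩

open Classical in
/-- Flip `T` at the variables whose literal disagreeing with `T` lies in `R`. -/
noncomputable def flipOn {V : Type*} (R : Set (V × Bool)) (T : V → Bool) (v : V) : Bool :=
  if (v, !T v) ∈ R then !T v else T v

theorem agrees_flipOn_of_mem {V : Type*} {R : Set (V × Bool)} {T : V → Bool}
    (hR : ∀ l ∈ R, negLit l ∉ R) {l : V × Bool} (hl : l ∈ R) : agrees (flipOn R T) l := by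
  obtain ⟨v, b⟩ := l
  have hn := hR _ hl
  unfold agrees flipOn
  by_cases hb : T v = b
  · subst hb
    exact if_neg hn
  · obtain rfl : b = !T v := by cases b <;> simp_all
    exact if_pos hl

theorem negLit_mem_of_agrees_of_not_agrees_flipOn {V : Type*} {R : Set (V × Bool)}
    {T : V → Bool} {l : V × Bool} (hT : agrees T l) (hf : ¬ agrees (flipOn R T) l) :
    negLit l ∈ R := by
  obtain ⟨v, b⟩ := l
  obtain rfl : T v = b := hT
  by_contra hn
  exact hf (if_neg hn)

theorem not_agrees_negLit {V : Type*} {T : V → Bool} {l : V × Bool} (h : agrees T l) :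
    ¬ agrees T (negLit l) := by
  simp_all [agrees, negLit]

theorem satisfies_flipOn_RAT {V : Type*} {F : Set ((V × Bool) × (V × Bool))}
    {A : Set (V × Bool)} {T : V → Bool} (hT : satisfies T F)
    (hR : ∀ l ∈ RAT F A T, negLit l ∉ RAT F A T) : satisfies (flipOn (RAT F A T) T) F := by
  intro c hc
  by_contra hcon
  obtain ⟨h₁, h₂⟩ := not_or.mp hcon
  rcases hT c hc with h | h
  · exact h₂ (agrees_flipOn_of_mem hR (mem_RAT_of_edge
      (negLit_mem_of_agrees_of_not_agrees_flipOn h h₁) ⟨c, hc, .inl ⟨rfl, rfl⟩⟩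
      (not_agrees_negLit h)))
  · exact h₁ (agrees_flipOn_of_mem hR (mem_RAT_of_edge
      (negLit_mem_of_agrees_of_not_agrees_flipOn h h₂) ⟨c, hc, .inr ⟨rfl, rfl⟩⟩
      (not_agrees_negLit h)))

theorem stmt0 {V : Type*} (F : Set ((V × Bool) × (V × Bool))) (T : V → Bool)
    (A : Set (V × Bool))
    (hT : satisfies T F)
    (hA : ∀ l ∈ A, negLit l ∉ A) :
    satUnder F A ↔ ¬ ∃ l : V × Bool, l ∈ RAT F A T ∧ negLit l ∈ RAT F A T := by
  constructor
  · rintro ⟨S, hS, hSA⟩ ⟨l, hl, hnl⟩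
    exact not_agrees_negLit (agrees_of_mem_RAT hS hSA hl) (agrees_of_mem_RAT hS hSA hnl)
  · intro h
    have hR : ∀ l ∈ RAT F A T, negLit l ∉ RAT F A T := fun l hl hnl => h ⟨l, hl, hnl⟩
    exact ⟨flipOn (RAT F A T) T, satisfies_flipOn_RAT hT hR,
      fun l hl => agrees_flipOn_of_mem hR ⟨l, hl, .refl⟩⟩
end

section
/- Let F be a 2-CNF formula over a variable type V, let T be a truth assignment that satisfies F, and let A be a set of literals such that R_{A,T} contains no pair of complementing literals. Define the truth assignment T' by: T' makes every literal of R_{A,T} agree with it (i.e., T'(v) = b whenever (v, b) ∈ R_{A,T}), and T'(v) = T(v) for every variable v such that neither literal over v belongs to R_{A,T}. Then T' is well defined, T' satisfies F, and every literal of A agrees with T'. -/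
theorem subset_RAT {V : Type*} (F : Set ((V × Bool) × (V × Bool))) (A : Set (V × Bool))
    (T : V → Bool) : A ⊆ RAT F A T :=
  fun l hl => ⟨l, hl, .refl⟩

theorem RAT_of_edge {V : Type*} {F : Set ((V × Bool) × (V × Bool))} {A : Set (V × Bool)}
    {T : V → Bool} {l l' : V × Bool} (hl : l ∈ RAT F A T) (he : edge F l l')
    (hd : ¬ agrees T l) : l' ∈ RAT F A T := by
  obtain ⟨a, ha, hal⟩ := hl
  exact ⟨a, ha, hal.tail ⟨he, hd⟩⟩

open Classical in
/-- The assignment `T` modified so that the literals of a set `R` agree with it. -/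
noncomputable def overrideAssignment {V : Type*} (R : Set (V × Bool)) (T : V → Bool) : V → Bool :=
  fun v => if (v, true) ∈ R then true else if (v, false) ∈ R then false else T v

theorem agrees_overrideAssignment {V : Type*} {R : Set (V × Bool)} (T : V → Bool)
    (hR : ¬ ∃ l : V × Bool, l ∈ R ∧ negLit l ∈ R) {l : V × Bool} (hl : l ∈ R) :
    agrees (overrideAssignment R T) l := by
  obtain ⟨v, _ | _⟩ := l
  · have hv : (v, true) ∉ R := fun h => hR ⟨_, hl, h⟩
    simp [agrees, overrideAssignment, hv, hl]
  · simp [agrees, overrideAssignment, hl]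

theorem negLit_mem_of_not_agrees_overrideAssignment {V : Type*} {R : Set (V × Bool)}
    {T : V → Bool} {l : V × Bool} (hl : agrees T l)
    (hl' : ¬ agrees (overrideAssignment R T) l) : negLit l ∈ R := by
  obtain ⟨v, b⟩ := l
  cases b <;> simp only [agrees, overrideAssignment, negLit] at * <;> grind

theorem stmt2 {V : Type*} (F : Set ((V × Bool) × (V × Bool))) (T : V → Bool)
    (A : Set (V × Bool))
    (hT : satisfies T F)
    (hR : ¬ ∃ l : V × Bool, l ∈ RAT F A T ∧ negLit l ∈ RAT F A T) :
    ∃ T' : V → Bool,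
      (∀ l ∈ RAT F A T, agrees T' l) ∧
      (∀ v : V, (v, true) ∉ RAT F A T → (v, false) ∉ RAT F A T → T' v = T v) ∧
      satisfies T' F ∧
      (∀ l ∈ A, agrees T' l) := by
  have agree : ∀ l ∈ RAT F A T, agrees (overrideAssignment (RAT F A T) T) l :=
    fun l hl => agrees_overrideAssignment T hR hl
  refine ⟨overrideAssignment (RAT F A T) T, agree, ?_, ?_,
    fun l hl => agree l (subset_RAT F A T hl)⟩
  · intro v h₁ h₂
    simp [overrideAssignment, h₁, h₂]
  · have step : ∀ l l', edge F (negLit l) l' → agrees T l →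
        ¬ agrees (overrideAssignment (RAT F A T) T) l →
        agrees (overrideAssignment (RAT F A T) T) l' := fun l l' he hl hl' =>
      agree l' (RAT_of_edge (negLit_mem_of_not_agrees_overrideAssignment hl hl') he
        (not_agrees_negLit hl))
    intro c hc
    rcases hT c hc with h | h
    · exact or_iff_not_imp_left.2 (step c.1 c.2 ⟨c, hc, .inl ⟨rfl, rfl⟩⟩ h)
    · exact or_iff_not_imp_right.2 (step c.2 c.1 ⟨c, hc, .inr ⟨rfl, rfl⟩⟩ h)
end
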